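/- arXiv:1108.1312 — 3 statements merged into one kernel-verified Lean document; each statement's English description precedes it below -/
import Mathlib

section
/- Let N ≥ 3 be an integer, let a, b > −2 and p ≥ q > 0 with pq > 1. Assume that 0 ≤ a − b ≤ (N−2)(p−q). Then every positive solution (u, v) of the Hardy–Hénon system on ℝ^N satisfies the pointwise comparison inequality |x|^a v(x)^{p+1}/(p+1) ≤ |x|^b u(x)^{q+1}/(q+1) for all x ∈ ℝ^N \ {0}. -/
open MeasureTheory Metric Set Filter

/-- The Euclidean Laplacian of `u : ℝ^N → ℝ`, as the sum of the second derivatives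
along the standard coordinate directions. -/
noncomputable def lap {N : ℕ} (u : EuclideanSpace ℝ (Fin N) → ℝ)
    (x : EuclideanSpace ℝ (Fin N)) : ℝ :=
  ∑ i : Fin N, iteratedFDeriv ℝ 2 u x ![EuclideanSpace.single i 1, EuclideanSpace.single i 1]

/-- `(u, v)` is a positive solution of the Hardy–Hénon system
`-Δu = |x|^a v^p`, `-Δv = |x|^b u^q` on the set `Ω`:
`u, v` are continuous on `Ω`, `C²` on `Ω \ {0}`, positive on `Ω`, and
the equations hold on `Ω \ {0}`. -/
def IsHHSol {N : ℕ} (a b p q : ℝ) (Ω : Set (EuclideanSpace ℝ (Fin N)))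
    (u v : EuclideanSpace ℝ (Fin N) → ℝ) : Prop :=
  ContinuousOn u Ω ∧ ContinuousOn v Ω ∧
  ContDiffOn ℝ 2 u (Ω \ {0}) ∧ ContDiffOn ℝ 2 v (Ω \ {0}) ∧
  (∀ x ∈ Ω, 0 < u x) ∧ (∀ x ∈ Ω, 0 < v x) ∧
  (∀ x ∈ Ω \ {0}, -lap u x = ‖x‖ ^ a * v x ^ p) ∧
  (∀ x ∈ Ω \ {0}, -lap v x = ‖x‖ ^ b * u x ^ q)

open Topology

/-- `f` is differentiable near `t`, with first derivative `d` and second derivative `s` at `t`. -/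
def HasTwoJet (f : ℝ → ℝ) (t d s : ℝ) : Prop :=
  ∃ f' : ℝ → ℝ, (∀ᶠ τ in 𝓝 t, HasDerivAt f (f' τ) τ) ∧ f' t = d ∧ HasDerivAt f' s t

namespace HasTwoJet

variable {f g φ : ℝ → ℝ} {t d s d' s' : ℝ}

lemma const (c t : ℝ) : HasTwoJet (fun _ => c) t 0 0 :=
  ⟨fun _ => 0, .of_forall fun τ => hasDerivAt_const τ c, rfl, hasDerivAt_const t 0⟩

lemma congr_jet (h : HasTwoJet f t d s) (hd : d = d') (hs : s = s') : HasTwoJet f t d' s' := by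
  subst hd hs; exact h

lemma add (hf : HasTwoJet f t d s) (hg : HasTwoJet g t d' s') :
    HasTwoJet (fun τ => f τ + g τ) t (d + d') (s + s') := by
  obtain ⟨f', h1, rfl, h3⟩ := hf
  obtain ⟨g', k1, rfl, k3⟩ := hg
  refine ⟨fun τ => f' τ + g' τ, ?_, rfl, h3.add k3⟩
  filter_upwards [h1, k1] with τ h k using h.add k

lemma mul (hf : HasTwoJet f t d s) (hg : HasTwoJet g t d' s') :
    HasTwoJet (fun τ => f τ * g τ) t (d * g t + f t * d') (s * g t + 2 * (d * d') + f t * s') := by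
  obtain ⟨f', h1, rfl, h3⟩ := hf
  obtain ⟨g', k1, rfl, k3⟩ := hg
  refine ⟨fun τ => f' τ * g τ + f τ * g' τ, ?_, rfl, ?_⟩
  · filter_upwards [h1, k1] with τ h k using h.mul k
  · refine ((h3.mul k1.self_of_nhds).add (h1.self_of_nhds.mul k3)).congr_deriv ?_
    ring

lemma comp (hφ : HasTwoJet φ (f t) d' s') (hf : HasTwoJet f t d s) :
    HasTwoJet (fun τ => φ (f τ)) t (d' * d) (s' * d ^ 2 + d' * s) := by
  obtain ⟨f', h1, rfl, h3⟩ := hf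
  obtain ⟨φ', k1, rfl, k3⟩ := hφ
  refine ⟨fun τ => φ' (f τ) * f' τ, ?_, rfl, ?_⟩
  · filter_upwards [h1, h1.self_of_nhds.continuousAt.eventually k1] with τ h k using k.comp τ h
  · refine ((k3.comp t h1.self_of_nhds).mul h3).congr_deriv ?_
    simp only [Function.comp]
    ring

lemma rpow (t α : ℝ) (ht : 0 < t) :
    HasTwoJet (fun τ => τ ^ α) t (α * t ^ (α - 1)) (α * ((α - 1) * t ^ (α - 2))) := by
  refine ⟨fun τ => α * τ ^ (α - 1), ?_, rfl, ?_⟩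
  · filter_upwards [lt_mem_nhds ht] with τ h using Real.hasDerivAt_rpow_const (Or.inl h.ne')
  · have := (Real.hasDerivAt_rpow_const (p := α - 1) (Or.inl ht.ne')).const_mul α
    rwa [show α - 1 - 1 = α - 2 by ring] at this

lemma nonpos_of_isLocalMax (h : HasTwoJet f t d s) (hm : IsLocalMax f t) : s ≤ 0 := by
  obtain ⟨f', h1, rfl, h3⟩ := h
  have e : deriv f =ᶠ[𝓝 t] f' := h1.mono fun τ h => h.deriv
  have hs : deriv (deriv f) t = s := e.deriv_eq.trans h3.deriv
  by_contra! hpos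
  have hmin := isLocalMin_of_deriv_deriv_pos (by rwa [hs]) hm.deriv_eq_zero
    h1.self_of_nhds.continuousAt
  have hc : f =ᶠ[𝓝 t] fun _ => f t := by
    filter_upwards [hm, hmin] with τ h k using le_antisymm h k
  have : deriv (deriv f) t = 0 := by
    rw [hc.deriv.deriv_eq]; simp
  linarith

end HasTwoJet

/-- `f` is twice differentiable at `x` along the coordinate lines, with gradient `g` and
Laplacian `L`. -/
def HasGradLap {N : ℕ} (f : EuclideanSpace ℝ (Fin N) → ℝ) (x : EuclideanSpace ℝ (Fin N))
    (g : Fin N → ℝ) (L : ℝ) : Prop :=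
  ∃ s : Fin N → ℝ,
    (∀ i, HasTwoJet (fun t : ℝ => f (x + t • EuclideanSpace.single i 1)) 0 (g i) (s i)) ∧
      ∑ i, s i = L

namespace HasGradLap

variable {N : ℕ} {f f₁ f₂ : EuclideanSpace ℝ (Fin N) → ℝ} {x : EuclideanSpace ℝ (Fin N)}
  {g g₁ g₂ : Fin N → ℝ} {L L₁ L₂ : ℝ}

lemma congr_jet (h : HasGradLap f₁ x g₁ L₁) (hg : ∀ i, g₁ i = g₂ i) (hL : L₁ = L₂) :
    HasGradLap f₁ x g₂ L₂ := by
  obtain rfl : g₁ = g₂ := funext hg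
  exact hL ▸ h

lemma add (h₁ : HasGradLap f₁ x g₁ L₁) (h₂ : HasGradLap f₂ x g₂ L₂) :
    HasGradLap (fun y => f₁ y + f₂ y) x (fun i => g₁ i + g₂ i) (L₁ + L₂) := by
  obtain ⟨s, hs, rfl⟩ := h₁
  obtain ⟨s', hs', rfl⟩ := h₂
  exact ⟨fun i => s i + s' i, fun i => (hs i).add (hs' i), Finset.sum_add_distrib⟩

lemma mul (h₁ : HasGradLap f₁ x g₁ L₁) (h₂ : HasGradLap f₂ x g₂ L₂) :
    HasGradLap (fun y => f₁ y * f₂ y) x (fun i => g₁ i * f₂ x + f₁ x * g₂ i)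
      (L₁ * f₂ x + 2 * ∑ i, g₁ i * g₂ i + f₁ x * L₂) := by
  obtain ⟨s, hs, rfl⟩ := h₁
  obtain ⟨s', hs', rfl⟩ := h₂
  refine ⟨fun i => s i * f₂ x + 2 * (g₁ i * g₂ i) + f₁ x * s' i, fun i => ?_, ?_⟩
  · refine ((hs i).mul (hs' i)).congr_jet ?_ ?_ <;> simp
  · simp only [Finset.sum_add_distrib, Finset.mul_sum, Finset.sum_mul]

lemma const (c : ℝ) (x : EuclideanSpace ℝ (Fin N)) : HasGradLap (fun _ => c) x (fun _ => 0) 0 :=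
  ⟨fun _ => 0, fun _ => HasTwoJet.const c 0, by simp⟩

lemma const_mul (c : ℝ) (h : HasGradLap f x g L) :
    HasGradLap (fun y => c * f y) x (fun i => c * g i) (c * L) :=
  ((const c x).mul h).congr_jet (fun i => by ring) (by simp)

lemma comp {φ : ℝ → ℝ} {d s : ℝ} (h : HasGradLap f x g L) (hφ : HasTwoJet φ (f x) d s) :
    HasGradLap (fun y => φ (f y)) x (fun i => d * g i) (s * ∑ i, g i ^ 2 + d * L) := by
  obtain ⟨r, hr, rfl⟩ := h
  refine ⟨fun i => s * g i ^ 2 + d * r i, fun i => ?_, ?_⟩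
  · exact HasTwoJet.comp (by simpa using hφ) (hr i)
  · simp only [Finset.sum_add_distrib, Finset.mul_sum]

lemma nonpos_of_isLocalMax (h : HasGradLap f x g L) (hm : IsLocalMax f x) : L ≤ 0 := by
  obtain ⟨s, hs, rfl⟩ := h
  refine Finset.sum_nonpos fun i _ => (hs i).nonpos_of_isLocalMax ?_
  have hc : ContinuousAt (fun t : ℝ => x + t • EuclideanSpace.single i (1 : ℝ)) 0 := by fun_prop
  have ht : Tendsto (fun t : ℝ => x + t • EuclideanSpace.single i (1 : ℝ)) (𝓝 0) (𝓝 x) := by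
    simpa [ContinuousAt] using hc
  filter_upwards [ht.eventually hm] with t h
  simpa only [Set.mem_ofPred_eq, zero_smul, add_zero] using h

lemma of_contDiffAt (h : ContDiffAt ℝ 2 f x) :
    HasGradLap f x (fun i => fderiv ℝ f x (EuclideanSpace.single i 1)) (lap f x) := by
  refine ⟨fun i => iteratedFDeriv ℝ 2 f x ![EuclideanSpace.single i 1, EuclideanSpace.single i 1],
    fun i => ?_, rfl⟩
  set e : EuclideanSpace ℝ (Fin N) := EuclideanSpace.single i 1
  have hl (t : ℝ) : HasDerivAt (fun t : ℝ => x + t • e) e t := by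
    simpa using ((hasDerivAt_id t).smul_const e).const_add x
  have ht : Tendsto (fun t : ℝ => x + t • e) (𝓝 0) (𝓝 x) := by
    simpa [ContinuousAt] using (hl 0).continuousAt
  refine ⟨fun t => fderiv ℝ f (x + t • e) e, ?_, by simp [e], ?_⟩
  · have := (h.of_le (m := 1) (by norm_num)).eventually (by simp)
    filter_upwards [ht.eventually this] with t h'
    exact (h'.differentiableAt (by simp)).hasFDerivAt.comp_hasDerivAt t (hl t)
  · have h2 : DifferentiableAt ℝ (fderiv ℝ f) (x + (0 : ℝ) • e) := by
      simpa using (h.fderiv_right (m := 1) (by norm_num)).differentiableAt (by simp)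
    have h3 : HasDerivAt (fun t : ℝ => fderiv ℝ f (x + t • e))
        (fderiv ℝ (fderiv ℝ f) (x + (0 : ℝ) • e) e) 0 :=
      h2.hasFDerivAt.comp_hasDerivAt (0 : ℝ) (hl 0)
    refine (h3.clm_apply (hasDerivAt_const (0 : ℝ) e)).congr_deriv ?_
    simp [iteratedFDeriv_two_apply, e]

lemma norm_sq (x : EuclideanSpace ℝ (Fin N)) :
    HasGradLap (fun y => ‖y‖ ^ 2) x (fun i => 2 * x i) (2 * N) := by
  refine ⟨fun _ => 2, fun i => ?_, by simp [mul_comm]⟩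
  have hE (t : ℝ) : ‖x + t • EuclideanSpace.single i (1 : ℝ)‖ ^ 2
      = ‖x‖ ^ 2 + 2 * x i * t + t ^ 2 := by
    rw [norm_add_sq_real, norm_smul, inner_smul_right]
    simp [EuclideanSpace.inner_single_right]
    ring
  simp only [hE]
  refine ⟨fun t => 2 * x i + 2 * t, .of_forall fun t => ?_, by simp, ?_⟩
  · refine ((((hasDerivAt_id t).const_mul (2 * x i)).const_add (‖x‖ ^ 2)).add
      (hasDerivAt_pow 2 t)).congr_deriv ?_
    simp
  · simpa using ((hasDerivAt_id (0 : ℝ)).const_mul 2).const_add (2 * x i)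

lemma norm_rpow (α : ℝ) (hx : x ≠ 0) :
    HasGradLap (fun y => ‖y‖ ^ α) x (fun i => α * ‖x‖ ^ (α - 2) * x i)
      (α * (α + N - 2) * ‖x‖ ^ (α - 2)) := by
  have hr : 0 < ‖x‖ := norm_pos_iff.2 hx
  have key := (norm_sq x).comp (HasTwoJet.rpow (‖x‖ ^ 2) (α / 2) (by positivity))
  have e (y : EuclideanSpace ℝ (Fin N)) (β : ℝ) : (‖y‖ ^ 2) ^ β = ‖y‖ ^ (2 * β) := by
    rw [Real.rpow_mul (norm_nonneg y), Real.rpow_two]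
  simp only [e, show 2 * (α / 2) = α by ring, show 2 * (α / 2 - 1) = α - 2 by ring,
    show 2 * (α / 2 - 2) = α - 2 - 2 by ring] at key
  refine key.congr_jet (fun i => by ring) ?_
  have hQ : ∑ i, (2 * x i) ^ 2 = 4 * ‖x‖ ^ 2 := by
    simp only [mul_pow, ← Finset.mul_sum, EuclideanSpace.real_norm_sq_eq]
    norm_num
  rw [hQ, Real.rpow_sub hr (α - 2) 2, Real.rpow_two]
  field_simp
  ring

end HasGradLap

/-- An upper bound for the Laplacian of the boundary blow-up barrier `(T - |x|^m)^(-k)`. -/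
lemma exists_hasGradLap_barrier {N : ℕ} (hN : 2 ≤ N) {x : EuclideanSpace ℝ (Fin N)} (hx : x ≠ 0)
    {m k T : ℝ} (hm : 0 < m) (hk : 0 < k) (hT : ‖x‖ ^ m < T) :
    ∃ g L, HasGradLap (fun y => (T - ‖y‖ ^ m) ^ (-k)) x g L ∧
      L ≤ (k * m * (m + N - 2) + k * (k + 1) * m ^ 2) * T * ‖x‖ ^ (m - 2) *
        (T - ‖x‖ ^ m) ^ (-k - 2) := by
  have hr : 0 < ‖x‖ := norm_pos_iff.2 hx
  have hN' : (2 : ℝ) ≤ N := by exact_mod_cast hN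
  have hd : 0 < T - ‖x‖ ^ m := by linarith
  have h1 := ((HasGradLap.norm_rpow m hx).const_mul (-1)).add (HasGradLap.const T x)
  have e : (fun y : EuclideanSpace ℝ (Fin N) => -1 * ‖y‖ ^ m + T) = fun y => T - ‖y‖ ^ m := by
    funext y; ring
  rw [e] at h1
  refine ⟨_, _, h1.comp (HasTwoJet.rpow (T - ‖x‖ ^ m) (-k) hd), ?_⟩
  set d := T - ‖x‖ ^ m
  have hsum : ∑ i, (-1 * (m * ‖x‖ ^ (m - 2) * x i) + 0) ^ 2
      = m ^ 2 * (‖x‖ ^ (m - 2) * ‖x‖ ^ m) := by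
    have e2 : ‖x‖ ^ m = ‖x‖ ^ (m - 2) * ‖x‖ ^ 2 := by
      rw [Real.rpow_sub hr, Real.rpow_two]; field_simp
    rw [e2, EuclideanSpace.real_norm_sq_eq, Finset.mul_sum, Finset.mul_sum, Finset.mul_sum]
    exact Finset.sum_congr rfl fun i _ => by ring
  have ed : d ^ (-k - 1) = d ^ (-k - 2) * d := by
    rw [← Real.rpow_add_one hd.ne']; congr 1; ring
  have hT0 : 0 ≤ ‖x‖ ^ m := by positivity
  have hD : 0 < d ^ (-k - 2) := by positivity
  have hR : 0 < ‖x‖ ^ (m - 2) := by positivity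
  rw [hsum, ed]
  have h2 : k * m * (m + N - 2) * d ≤ k * m * (m + N - 2) * T := by
    gcongr
    · have : 0 ≤ m + N - 2 := by linarith
      positivity
    · simp only [d]; linarith
  have h3 : k * (k + 1) * m ^ 2 * ‖x‖ ^ m ≤ k * (k + 1) * m ^ 2 * T := by gcongr
  have := mul_le_mul_of_nonneg_left (add_le_add h2 h3) (mul_pos hR hD).le
  linarith

/-- `Δ(|x|^(-h) u^σ) ≤ σ |x|^(-h) u^(σ - 1) Δu` when `0 ≤ h ≤ (N - 2)(1 - σ)`. -/
lemma exists_hasGradLap_norm_rpow_mul_rpow {N : ℕ} {u : EuclideanSpace ℝ (Fin N) → ℝ}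
    {x : EuclideanSpace ℝ (Fin N)} (hx : x ≠ 0) {h σ : ℝ} (hh : 0 ≤ h) (hσ : 0 < σ) (hσ1 : σ ≤ 1)
    (hhσ : h ≤ ((N : ℝ) - 2) * (1 - σ)) (hu : 0 < u x) {g : Fin N → ℝ} {L : ℝ}
    (hg : HasGradLap u x g L) :
    ∃ g' L', HasGradLap (fun y => ‖y‖ ^ (-h) * u y ^ σ) x g' L' ∧
      L' ≤ σ * (‖x‖ ^ (-h) * u x ^ σ) * (L / u x) := by
  have hr : 0 < ‖x‖ := norm_pos_iff.2 hx
  refine ⟨_, _, (HasGradLap.norm_rpow (-h) hx).mul (hg.comp (HasTwoJet.rpow (u x) σ hu)), ?_⟩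
  set S := ∑ i, x i * g i
  set G := ∑ i, g i ^ 2
  have hsum : ∑ i, -h * ‖x‖ ^ (-h - 2) * x i * (σ * u x ^ (σ - 1) * g i)
      = -h * ‖x‖ ^ (-h - 2) * (σ * u x ^ (σ - 1)) * S := by
    rw [Finset.mul_sum]
    exact Finset.sum_congr rfl fun i _ => by ring
  have hCS : S ^ 2 ≤ ‖x‖ ^ 2 * G := by
    rw [EuclideanSpace.real_norm_sq_eq]
    exact Finset.sum_mul_sq_le_sq_mul_sq _ _ _
  have hG : 0 ≤ G := Finset.sum_nonneg fun i _ => sq_nonneg _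
  rw [hsum, Real.rpow_sub hr, Real.rpow_sub hu, Real.rpow_sub hu, Real.rpow_two, Real.rpow_two,
    Real.rpow_one]
  set r := ‖x‖
  set U := u x
  have hquad : 0 ≤ σ * (1 - σ) * G * r ^ 2 + 2 * h * σ * S * U + h * (N - 2 - h) * U ^ 2 := by
    rcases hh.eq_or_lt with rfl | hh
    · have : 0 ≤ 1 - σ := by linarith
      have : 0 ≤ σ * (1 - σ) * G * r ^ 2 := by positivity
      linarith
    · have hH : 0 < 1 - σ := by
        rcases hσ1.eq_or_lt with rfl | h'
        · linarith
        · linarith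
      refine nonneg_of_mul_nonneg_right ?_ hH
      have h1 : σ * (1 - σ) ^ 2 * S ^ 2 ≤ σ * (1 - σ) ^ 2 * (r ^ 2 * G) := by gcongr
      have h2 : h * U ^ 2 * h ≤ h * U ^ 2 * ((N - 2) * (1 - σ)) := by gcongr
      have h3 : 0 ≤ σ * ((1 - σ) * S + h * U) ^ 2 := by positivity
      nlinarith
  have hP : 0 < r ^ (-h) := by positivity
  have hQ : 0 < U ^ σ := by positivity
  have : 0 ≤ r ^ (-h) * U ^ σ / (r ^ 2 * U ^ 2) *
      (σ * (1 - σ) * G * r ^ 2 + 2 * h * σ * S * U + h * (N - 2 - h) * U ^ 2) := by positivity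
  rw [← sub_nonneg]
  convert this using 1
  field_simp
  ring

lemma rpow_sub_le_rpow_mul_rpow_sub_rpow {F V p κ : ℝ} (hF : 0 < F) (hV : F < V)
    (hκ : 0 ≤ κ) (hp : κ + 1 ≤ p) : (V - F) ^ (p - κ) ≤ F ^ (-κ) * (V ^ p - F ^ p) := by
  have hV0 : 0 < V := hF.trans hV
  have hw : 0 < V - F := sub_pos.2 hV
  have h1 : V ^ (p - 1) * (V - F) ≤ V ^ p - F ^ p := by
    have e1 : V ^ p = V ^ (p - 1) * V := by rw [← Real.rpow_add_one hV0.ne']; ring_nf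
    have e2 : F ^ p = F ^ (p - 1) * F := by rw [← Real.rpow_add_one hF.ne']; ring_nf
    have : F ^ (p - 1) ≤ V ^ (p - 1) := Real.rpow_le_rpow hF.le hV.le (by linarith)
    rw [e1, e2]
    nlinarith
  have h2 : V ^ (-κ) ≤ F ^ (-κ) := Real.rpow_le_rpow_of_nonpos hF hV.le (by linarith)
  have h3 : (V - F) ^ (p - κ - 1) ≤ V ^ (p - κ - 1) :=
    Real.rpow_le_rpow hw.le (by linarith) (by linarith)
  calc (V - F) ^ (p - κ) = (V - F) ^ (p - κ - 1) * (V - F) := by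
        rw [← Real.rpow_add_one hw.ne']; ring_nf
    _ ≤ V ^ (p - κ - 1) * (V - F) := by gcongr
    _ = V ^ (-κ) * (V ^ (p - 1) * (V - F)) := by
        rw [← mul_assoc, ← Real.rpow_add hV0]; ring_nf
    _ ≤ F ^ (-κ) * (V ^ p - F ^ p) := by gcongr

/-- A Keller–Osserman bound, uniform in the weight `ε` of the fundamental solution that absorbs
the singularity at the origin. -/
lemma le_barrier {N : ℕ} (hN : 3 ≤ N) {w : EuclideanSpace ℝ (Fin N) → ℝ} {K m s B : ℝ}
    (hK : 0 < K) (hm : 0 < m) (hs : 1 < s) (hw : ContinuousOn w {0}ᶜ)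
    (hbdd : ∀ R, ∃ M, ∀ x, x ≠ 0 → ‖x‖ ≤ R → w x ≤ M)
    (hlap : ∀ x, x ≠ 0 → 0 < w x → ∃ g L, HasGradLap w x g L ∧ K * ‖x‖ ^ (m - 2) * w x ^ s ≤ L)
    (hB : 0 < B)
    (hBK : 2 / (s - 1) * m * (m + N - 2) + 2 / (s - 1) * (2 / (s - 1) + 1) * m ^ 2
      < K * B ^ (s - 1))
    {T ε : ℝ} (hε : 0 < ε) {x₀ : EuclideanSpace ℝ (Fin N)} (hx₀ : x₀ ≠ 0) (hT : ‖x₀‖ ^ m < T) :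
    w x₀ ≤ B * T ^ (1 / (s - 1)) * (T - ‖x₀‖ ^ m) ^ (-(2 / (s - 1))) + ε * ‖x₀‖ ^ (2 - N : ℝ) := by
  have hs' : 0 < s - 1 := by linarith
  have hN' : (3 : ℝ) ≤ N := by exact_mod_cast hN
  have hr₀ : 0 < ‖x₀‖ := norm_pos_iff.2 hx₀
  have hT0 : 0 < T := lt_of_le_of_lt (by positivity) hT
  set k := 2 / (s - 1) with hk
  have hk0 : 0 < k := by positivity
  set A := B * T ^ (1 / (s - 1)) with hA
  have hA0 : 0 < A := by positivity
  by_contra! hcon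
  set G : EuclideanSpace ℝ (Fin N) → ℝ := fun y =>
    w y + -A * (T - ‖y‖ ^ m) ^ (-k) + -ε * ‖y‖ ^ (2 - N : ℝ) with hG
  have hG0 : 0 < G x₀ := by simp only [hG]; linarith
  obtain ⟨M, hM⟩ := hbdd (T ^ (1 / m))
  have hle {y : EuclideanSpace ℝ (Fin N)} (hyT : ‖y‖ ^ m < T) : ‖y‖ ≤ T ^ (1 / m) :=
    calc ‖y‖ = (‖y‖ ^ m) ^ (1 / m) := by
          rw [← Real.rpow_mul (norm_nonneg y), mul_one_div_cancel hm.ne', Real.rpow_one]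
      _ ≤ T ^ (1 / m) := by gcongr
  obtain ⟨δ, hδM, hδ0, hδx⟩ : ∃ δ, M < ε * δ ^ (2 - N : ℝ) ∧ 0 < δ ∧ δ < ‖x₀‖ := by
    have h1 := (tendsto_rpow_neg_nhdsGT_zero (y := 2 - N) (by linarith)).const_mul_atTop hε
    exact ((h1.eventually_gt_atTop M).and (Ioo_mem_nhdsGT hr₀)).exists
  obtain ⟨η, hηM, hη0, hηx⟩ : ∃ η, M < A * η ^ (-k) ∧ 0 < η ∧ η < T - ‖x₀‖ ^ m := by
    have h1 := (tendsto_rpow_neg_nhdsGT_zero (y := -k) (by linarith)).const_mul_atTop hA0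
    exact ((h1.eventually_gt_atTop M).and (Ioo_mem_nhdsGT (sub_pos.2 hT))).exists
  have hnc : Continuous fun y : EuclideanSpace ℝ (Fin N) => ‖y‖ ^ m :=
    continuous_norm.rpow_const fun _ => Or.inr hm.le
  set C : Set (EuclideanSpace ℝ (Fin N)) := {y | δ ≤ ‖y‖} ∩ {y | ‖y‖ ^ m ≤ T - η} with hC
  have hC0 : ∀ y ∈ C, y ≠ 0 ∧ ‖y‖ ^ m < T := fun y hy =>
    ⟨norm_pos_iff.1 (hδ0.trans_le hy.1), lt_of_le_of_lt hy.2 (by linarith)⟩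
  have hCc : IsCompact C := by
    refine Metric.isCompact_of_isClosed_isBounded
      ((isClosed_le continuous_const continuous_norm).inter (isClosed_le hnc continuous_const)) ?_
    refine (Metric.isBounded_closedBall (x := 0) (r := T ^ (1 / m))).subset fun y hy => ?_
    exact mem_closedBall_zero_iff.2 (hle (hC0 y hy).2)
  have hGc : ContinuousOn G C := by
    refine ((hw.mono fun y hy => (hC0 y hy).1).add ?_).add ?_
    · refine continuousOn_const.mul ((continuous_const.sub hnc).continuousOn.rpow_const ?_)
      exact fun y hy => Or.inl (sub_pos.2 (hC0 y hy).2).ne'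
    · refine continuousOn_const.mul (continuous_norm.continuousOn.rpow_const ?_)
      exact fun y hy => Or.inl (norm_ne_zero_iff.2 (hC0 y hy).1)
  have hx₀C : x₀ ∈ C := ⟨hδx.le, by simp only [Set.mem_ofPred_eq]; linarith⟩
  obtain ⟨y, hyC, hymax⟩ := hCc.exists_isMaxOn ⟨x₀, hx₀C⟩ hGc
  have hGy : 0 < G y := hG0.trans_le (hymax hx₀C)
  obtain ⟨hy0, hyT⟩ := hC0 y hyC
  have hr : 0 < ‖y‖ := norm_pos_iff.2 hy0
  have hwM := hM y hy0 (hle hyT)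
  have hd : 0 < T - ‖y‖ ^ m := sub_pos.2 hyT
  have hψ : 0 < A * (T - ‖y‖ ^ m) ^ (-k) := by positivity
  have hE : 0 < ε * ‖y‖ ^ (2 - N : ℝ) := by positivity
  have hyδ : δ < ‖y‖ := by
    refine lt_of_le_of_ne hyC.1 fun h => ?_
    simp only [hG, ← h] at hGy hψ
    linarith
  have hyη : ‖y‖ ^ m < T - η := by
    refine lt_of_le_of_ne hyC.2 fun h => ?_
    have e : T - ‖y‖ ^ m = η := by linarith
    simp only [hG, e] at hGy
    linarith
  have hloc : IsLocalMax G y := by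
    refine hymax.isLocalMax ?_
    filter_upwards [continuous_norm.continuousAt.eventually (lt_mem_nhds hyδ),
      hnc.continuousAt.eventually (gt_mem_nhds hyη)] with z h1 h2 using ⟨h1.le, h2.le⟩
  have hwψ : A * (T - ‖y‖ ^ m) ^ (-k) < w y := by
    simp only [hG] at hGy
    linarith
  obtain ⟨g₁, L₁, hL₁, hL₁'⟩ := hlap y hy0 (hψ.trans hwψ)
  obtain ⟨g₂, L₂, hL₂, hL₂'⟩ := exists_hasGradLap_barrier (by omega) hy0 hm hk0 hyT
  have hL := ((hL₁.add (hL₂.const_mul (-A))).add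
    ((HasGradLap.norm_rpow (2 - N) hy0).const_mul (-ε))).nonpos_of_isLocalMax hloc
  have hAs : A ^ s = A * (B ^ (s - 1) * T) := by
    have h1 : A ^ s = A * A ^ (s - 1) := by
      rw [mul_comm, ← Real.rpow_add_one hA0.ne']; ring_nf
    rw [h1, hA, Real.mul_rpow hB.le (by positivity), ← Real.rpow_mul hT0.le,
      one_div_mul_cancel hs'.ne', Real.rpow_one]
  have hds : ((T - ‖y‖ ^ m) ^ (-k)) ^ s = (T - ‖y‖ ^ m) ^ (-k - 2) := by
    rw [← Real.rpow_mul hd.le]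
    congr 1
    rw [hk]
    field_simp
    ring
  have hpow : A * (B ^ (s - 1) * T) * (T - ‖y‖ ^ m) ^ (-k - 2) ≤ w y ^ s := by
    rw [← hAs, ← hds, ← Real.mul_rpow hA0.le (by positivity)]
    exact Real.rpow_le_rpow hψ.le hwψ.le (by linarith)
  have hX : 0 < A * T * ‖y‖ ^ (m - 2) * (T - ‖y‖ ^ m) ^ (-k - 2) := by positivity
  have i1 := mul_lt_mul_of_pos_right hBK hX
  have i2 := mul_le_mul_of_nonneg_left hpow (show 0 ≤ K * ‖y‖ ^ (m - 2) by positivity)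
  have i3 := mul_le_mul_of_nonneg_left hL₂' hA0.le
  have i4 : -ε * ((2 - N) * (2 - N + N - 2) * ‖y‖ ^ (2 - N - 2 : ℝ)) = 0 := by ring
  rw [i4] at hL
  linarith

/-- A function on `ℝ^N \ {0}`, locally bounded above at the origin, with
`K |x|^(m - 2) w^s ≤ Δw` wherever `w > 0`, is nonpositive if `m > 0` and `s > 1`. -/
lemma nonpos_of_keller_osserman {N : ℕ} (hN : 3 ≤ N) {w : EuclideanSpace ℝ (Fin N) → ℝ}
    {K m s : ℝ} (hK : 0 < K) (hm : 0 < m) (hs : 1 < s) (hw : ContinuousOn w {0}ᶜ)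
    (hbdd : ∀ R, ∃ M, ∀ x, x ≠ 0 → ‖x‖ ≤ R → w x ≤ M)
    (hlap : ∀ x, x ≠ 0 → 0 < w x → ∃ g L, HasGradLap w x g L ∧ K * ‖x‖ ^ (m - 2) * w x ^ s ≤ L)
    {x : EuclideanSpace ℝ (Fin N)} (hx : x ≠ 0) : w x ≤ 0 := by
  have hs' : 0 < s - 1 := by linarith
  have hN' : (3 : ℝ) ≤ N := by exact_mod_cast hN
  have hr : 0 < ‖x‖ := norm_pos_iff.2 hx
  have hρ : 0 < ‖x‖ ^ m := by positivity
  set c := 2 / (s - 1) * m * (m + N - 2) + 2 / (s - 1) * (2 / (s - 1) + 1) * m ^ 2 with hc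
  have hc0 : 0 < c := by
    have : 0 < m + N - 2 := by linarith
    positivity
  set B := ((c + 1) / K) ^ (1 / (s - 1)) with hB
  have hB0 : 0 < B := by positivity
  have hBK : c < K * B ^ (s - 1) := by
    rw [hB, ← Real.rpow_mul (by positivity), one_div_mul_cancel hs'.ne', Real.rpow_one,
      mul_div_cancel₀ _ hK.ne']
    linarith
  have key (t : ℝ) (ht : 0 < t) :
      w x ≤ B * (‖x‖ ^ m * (t⁻¹ * t⁻¹) + t⁻¹) ^ (1 / (s - 1)) := by
    refine le_of_forall_pos_le_add fun ε hε => ?_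
    have hE : 0 < ‖x‖ ^ (2 - N : ℝ) := by positivity
    have := le_barrier hN hK hm hs hw hbdd hlap hB0 hBK (T := ‖x‖ ^ m + t)
      (div_pos hε hE) hx (by linarith)
    rw [div_mul_cancel₀ _ hE.ne', add_sub_cancel_left] at this
    refine this.trans_eq ?_
    congr 1
    have e : t ^ (-(2 / (s - 1))) = (t⁻¹ * t⁻¹) ^ (1 / (s - 1)) := by
      rw [Real.rpow_neg ht.le, ← mul_inv, Real.inv_rpow (by positivity), ← sq, ← Real.rpow_two,
        ← Real.rpow_mul ht.le, mul_one_div]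
    rw [e, mul_assoc, ← Real.mul_rpow (by positivity) (by positivity)]
    congr 2
    field_simp
  have hi : Tendsto (fun t : ℝ => t⁻¹) atTop (𝓝 0) := tendsto_inv_atTop_zero
  have hlim : Tendsto (fun t : ℝ => B * (‖x‖ ^ m * (t⁻¹ * t⁻¹) + t⁻¹) ^ (1 / (s - 1))) atTop
      (𝓝 (B * (‖x‖ ^ m * (0 * 0) + 0) ^ (1 / (s - 1)))) :=
    ((((hi.mul hi).const_mul (‖x‖ ^ m)).add hi).rpow_const
      (Or.inr (by positivity))).const_mul B
  rw [mul_zero, mul_zero, add_zero, Real.zero_rpow (by positivity), mul_zero] at hlim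
  exact ge_of_tendsto hlim ((eventually_gt_atTop 0).mono key)

/-- Lemma 2.7: comparison property between the two components of a positive solution of the
Hardy–Hénon system on `ℝ^N`, under the condition `0 ≤ a - b ≤ (N-2)(p-q)`. -/
theorem comparison_property
    (N : ℕ) (hN : 3 ≤ N) (a b p q : ℝ) (ha : -2 < a) (hb : -2 < b)
    (hq : 0 < q) (hqp : q ≤ p) (hpq : 1 < p * q)
    (hab : 0 ≤ a - b) (hab' : a - b ≤ ((N : ℝ) - 2) * (p - q))
    (u v : EuclideanSpace ℝ (Fin N) → ℝ)
    (huv : IsHHSol a b p q (univ : Set (EuclideanSpace ℝ (Fin N))) u v) :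
    ∀ x : EuclideanSpace ℝ (Fin N), x ≠ 0 →
      ‖x‖ ^ a * v x ^ (p + 1) / (p + 1) ≤ ‖x‖ ^ b * u x ^ (q + 1) / (q + 1) := by
  obtain ⟨huc, hvc, hu2, hv2, hu, hv, hΔu, hΔv⟩ := huv
  have hp : 0 < p := hq.trans_le hqp
  have hp1 : 0 < p + 1 := by linarith
  have hq1 : 0 < q + 1 := by linarith
  have hC2 {f : EuclideanSpace ℝ (Fin N) → ℝ} (hf : ContDiffOn ℝ 2 f (univ \ {0}))
      {x : EuclideanSpace ℝ (Fin N)} (hx : x ≠ 0) : ContDiffAt ℝ 2 f x :=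
    hf.contDiffAt ((isOpen_univ.sdiff isClosed_singleton).mem_nhds ⟨mem_univ x, hx⟩)
  set σ := (q + 1) / (p + 1) with hσ
  set h := (a - b) / (p + 1) with hh
  set κ := (p - q) / (q + 1) with hκ
  have hσ0 : 0 < σ := by positivity
  have hσ1 : σ ≤ 1 := by rw [hσ, div_le_one hp1]; linarith
  have hh0 : 0 ≤ h := by positivity
  have hκ0 : 0 ≤ κ := div_nonneg (by linarith) hq1.le
  have hhσ : h ≤ ((N : ℝ) - 2) * (1 - σ) := by
    have e : ((N : ℝ) - 2) * (1 - σ) = (N - 2) * (p - q) / (p + 1) := by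
      rw [hσ]; field_simp; ring
    rw [e, hh]
    gcongr
  have hκp : κ + 1 < p := by
    rw [hκ, ← sub_pos, show p - ((p - q) / (q + 1) + 1) = (p * q - 1) / (q + 1) by
      field_simp; ring]
    exact div_pos (by linarith) hq1
  have hm : 0 < a - h * (κ + 1) + 2 := by
    have e : a - h * (κ + 1) + 2 = (q * (a + 2) + (b + 2)) / (q + 1) := by
      rw [hκ, hh]; field_simp; ring
    rw [e]
    have : 0 < q * (a + 2) := mul_pos hq (by linarith)
    exact div_pos (by linarith) hq1
  have hσκ : σ * (κ + 1) = 1 := by rw [hσ, hκ]; field_simp; ring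
  set l := σ⁻¹ ^ (1 / (p + 1)) with hl
  have hl0 : 0 < l := by positivity
  have hF1 {r U : ℝ} (hr : 0 < r) (hU : 0 < U) :
      σ * (l * (r ^ (-h) * U ^ σ)) ^ (p + 1) * r ^ a = r ^ b * U ^ (q + 1) := by
    rw [Real.mul_rpow hl0.le (by positivity), Real.mul_rpow (by positivity) (by positivity), hl,
      ← Real.rpow_mul (by positivity), ← Real.rpow_mul hr.le, ← Real.rpow_mul hU.le,
      one_div_mul_cancel hp1.ne', Real.rpow_one,
      show -h * (p + 1) = b - a by rw [hh]; field_simp; ring,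
      show σ * (p + 1) = q + 1 by rw [hσ]; field_simp, Real.rpow_sub hr]
    field_simp
  have hF2 {r U : ℝ} (hr : 0 < r) (hU : 0 < U) :
      l * (r ^ (-h) * U ^ σ) = (l * (r ^ (-h) * U ^ σ)) ^ (-κ) *
        (l ^ (κ + 1) * r ^ (-(h * (κ + 1))) * U) := by
    have e : l ^ (κ + 1) * r ^ (-(h * (κ + 1))) * U = (l * (r ^ (-h) * U ^ σ)) ^ (κ + 1) := by
      rw [Real.mul_rpow hl0.le (by positivity), Real.mul_rpow (by positivity) (by positivity),
        ← Real.rpow_mul hr.le, ← Real.rpow_mul hU.le, hσκ, Real.rpow_one, neg_mul, mul_assoc]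
    rw [e, ← Real.rpow_add (by positivity), neg_add_cancel_left, Real.rpow_one]
  have hw {x : EuclideanSpace ℝ (Fin N)} (hx : x ≠ 0) :
      v x + -l * (‖x‖ ^ (-h) * u x ^ σ) ≤ 0 := by
    refine nonpos_of_keller_osserman (w := fun x => v x + -l * (‖x‖ ^ (-h) * u x ^ σ))
      (K := σ * l ^ (κ + 1)) (s := p - κ) hN (by positivity) hm (by linarith) ?_ ?_ ?_ hx
    · refine (hvc.mono (subset_univ _)).add (continuousOn_const.mul (ContinuousOn.mul ?_ ?_))
      · exact continuous_norm.continuousOn.rpow_const fun y hy => Or.inl (norm_ne_zero_iff.2 hy)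
      · exact (huc.mono (subset_univ _)).rpow_const fun y _ => Or.inl (hu y (mem_univ y)).ne'
    · intro R
      obtain ⟨M, hM⟩ := (isCompact_closedBall (0 : EuclideanSpace ℝ (Fin N)) R).bddAbove_image
        (hvc.mono (subset_univ _))
      refine ⟨M, fun y _ hyR => ?_⟩
      have h1 : v y ≤ M := hM ⟨y, by simpa using hyR, rfl⟩
      have h2 := hu y (mem_univ y)
      have h3 : 0 ≤ l * (‖y‖ ^ (-h) * u y ^ σ) := by positivity
      linarith
    · intro y hy hwy
      have hr : 0 < ‖y‖ := norm_pos_iff.2 hy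
      have hU := hu y (mem_univ y)
      obtain ⟨g, L, hgL, hL⟩ := exists_hasGradLap_norm_rpow_mul_rpow hy hh0 hσ0 hσ1 hhσ hU
        (HasGradLap.of_contDiffAt (hC2 hu2 hy))
      refine ⟨_, _, (HasGradLap.of_contDiffAt (hC2 hv2 hy)).add (hgL.const_mul (-l)), ?_⟩
      have e1 : lap u y = -(‖y‖ ^ a * v y ^ p) := by linarith [hΔu y ⟨mem_univ y, hy⟩]
      have e2 : lap v y = -(‖y‖ ^ b * u y ^ q) := by linarith [hΔv y ⟨mem_univ y, hy⟩]
      have hf1 := hF1 hr hU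
      have hf2 := hF2 hr hU
      rw [e1] at hL
      rw [e2]
      set F := l * (‖y‖ ^ (-h) * u y ^ σ) with hF
      have hF0 : 0 < F := by positivity
      have hwF : v y + -l * (‖y‖ ^ (-h) * u y ^ σ) = v y - F := by rw [hF]; ring
      rw [hwF] at hwy ⊢
      have hineq := rpow_sub_le_rpow_mul_rpow_sub_rpow hF0 (sub_pos.1 hwy) hκ0 hκp.le
      have e3 : ‖y‖ ^ b * u y ^ q = σ * ‖y‖ ^ a * (F / u y) * F ^ p := by
        rw [Real.rpow_add_one hU.ne', Real.rpow_add_one hF0.ne'] at hf1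
        field_simp
        linarith
      have e4 : F / u y = F ^ (-κ) * (l ^ (κ + 1) * ‖y‖ ^ (-(h * (κ + 1)))) := by
        rw [div_eq_iff hU.ne']
        linarith
      have e5 : ‖y‖ ^ (a - h * (κ + 1) + 2 - 2) = ‖y‖ ^ a * ‖y‖ ^ (-(h * (κ + 1))) := by
        rw [← Real.rpow_add hr]; ring_nf
      calc σ * l ^ (κ + 1) * ‖y‖ ^ (a - h * (κ + 1) + 2 - 2) * (v y - F) ^ (p - κ)
          ≤ σ * l ^ (κ + 1) * ‖y‖ ^ (a - h * (κ + 1) + 2 - 2) *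
              (F ^ (-κ) * (v y ^ p - F ^ p)) := by gcongr
        _ = σ * ‖y‖ ^ a * (F / u y) * (v y ^ p - F ^ p) := by rw [e4, e5]; ring
        _ = -(‖y‖ ^ b * u y ^ q) +
              -l * (σ * (‖y‖ ^ (-h) * u y ^ σ) * (-(‖y‖ ^ a * v y ^ p) / u y)) := by
            rw [e3, hF]; ring
        _ ≤ -(‖y‖ ^ b * u y ^ q) + -l * L := by
            have := mul_le_mul_of_nonneg_left hL hl0.le
            linarith
  intro x hx
  have hr : 0 < ‖x‖ := norm_pos_iff.2 hx
  have hU := hu x (mem_univ x)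
  have hV := hv x (mem_univ x)
  have hVF : v x ≤ l * (‖x‖ ^ (-h) * u x ^ σ) := by linarith [hw hx]
  have hpow : v x ^ (p + 1) ≤ (l * (‖x‖ ^ (-h) * u x ^ σ)) ^ (p + 1) := by gcongr
  rw [← hF1 hr hU]
  calc ‖x‖ ^ a * v x ^ (p + 1) / (p + 1)
      ≤ ‖x‖ ^ a * (l * (‖x‖ ^ (-h) * u x ^ σ)) ^ (p + 1) / (p + 1) := by gcongr
    _ = σ * (l * (‖x‖ ^ (-h) * u x ^ σ)) ^ (p + 1) * ‖x‖ ^ a / (q + 1) := by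
      rw [hσ]; field_simp
end

section
/- Let N ≥ 3 be an integer, let a, b > −2 and p, q > 0 with pq > 1, let Ω ⊆ ℝ^N be a domain containing the origin, and let (u, v) be a positive solution of the Hardy–Hénon system on Ω. Then there exists a sequence of positive numbers ε_i converging to 0 such that ∫_{|x| = ε_i} ( |∇u|² + |∇v|² ) dσ → 0 as i → ∞, where dσ denotes the surface measure on the sphere {x : |x| = ε_i}. -/
open MeasureTheory Metric Set Filter

/-- The surface integral of `f` over the sphere `{x : ‖x‖ = R}` in `ℝ^N`, expressed via the
canonical surface measure `volume.toSphere` on the unit sphere, scaled by `R^(N-1)`. -/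
noncomputable def sphInt {N : ℕ} (R : ℝ) (f : EuclideanSpace ℝ (Fin N) → ℝ) : ℝ :=
  R ^ (N - 1) * ∫ θ : sphere (0 : EuclideanSpace ℝ (Fin N)) 1,
    f (R • (θ : EuclideanSpace ℝ (Fin N)))
      ∂((volume : Measure (EuclideanSpace ℝ (Fin N))).toSphere)

open Module in
lemma exists_sphere_integral_le {N : ℕ} (hN : 0 < N) :
    ∃ c : ℝ, 0 < c ∧ ∀ Φ : EuclideanSpace ℝ (Fin N) → ℝ, (∀ x, 0 ≤ Φ x) → Integrable Φ →
      ∃ r ∈ Ico (1 : ℝ) 2, c * ∫ θ : sphere (0 : EuclideanSpace ℝ (Fin N)) 1,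
        Φ (r • (θ : EuclideanSpace ℝ (Fin N)))
          ∂((volume : Measure (EuclideanSpace ℝ (Fin N))).toSphere) ≤ ∫ x, Φ x := by
  set E := EuclideanSpace ℝ (Fin N)
  have : Nontrivial E := by
    have : Nonempty (Fin N) := ⟨⟨0, hN⟩⟩
    infer_instance
  set ν : Measure (Ioi (0 : ℝ)) := Measure.volumeIoiPow (finrank ℝ E - 1)
  set s : Set (Ioi (0 : ℝ)) := Iio ⟨2, by norm_num⟩ \ Iio ⟨1, by norm_num⟩
  have hν2 : ν (Iio ⟨2, by norm_num⟩) ≠ ⊤ := by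
    simp [ν, Measure.volumeIoiPow_apply_Iio]
  have hs_top : ν s ≠ ⊤ := ((measure_mono sdiff_subset).trans_lt hν2.lt_top).ne
  have hs_zero : ν s ≠ 0 := by
    have h1 : ν (Iio ⟨1, by norm_num⟩) < ν (Iio ⟨2, by norm_num⟩) := by
      simp only [ν, Measure.volumeIoiPow_apply_Iio]
      rw [ENNReal.ofReal_lt_ofReal_iff (by positivity)]
      gcongr
      norm_num
    have h2 := le_measure_sdiff (μ := ν) (s₁ := Iio ⟨2, by norm_num⟩) (s₂ := Iio ⟨1, by norm_num⟩)
    exact ((tsub_pos_of_lt h1).trans_le h2).ne'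
  refine ⟨ν.real s, ENNReal.toReal_pos hs_zero hs_top, fun Φ hΦ0 hΦ => ?_⟩
  have hmp := (volume : Measure E).measurePreserving_homeomorphUnitSphereProd
  have hemb := (homeomorphUnitSphereProd E).measurableEmbedding
  set Ψ : sphere (0 : E) 1 × Ioi (0 : ℝ) → ℝ := fun z => Φ (z.2.1 • z.1.1)
  have hcomp : ∀ x : ({0}ᶜ : Set E), Ψ (homeomorphUnitSphereProd E x) = Φ x := by
    intro x
    have := congrArg Subtype.val ((homeomorphUnitSphereProd E).symm_apply_apply x)
    simp only [homeomorphUnitSphereProd_symm_apply_coe] at this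
    simp only [Ψ, this]
  have hint : ∫ x, Φ x = ∫ z, Ψ z ∂((volume : Measure E).toSphere.prod ν) := by
    rw [← hmp.integral_comp hemb]
    simp only [hcomp]
    rw [integral_subtype_comap (measurableSet_singleton _).compl Φ, restrict_compl_singleton]
  have hΨ : Integrable Ψ ((volume : Measure E).toSphere.prod ν) := by
    rw [← hmp.integrable_comp_emb hemb]
    have : Ψ ∘ homeomorphUnitSphereProd E = Φ ∘ Subtype.val := funext hcomp
    rw [this, ← integrableOn_iff_comap_subtypeVal (by measurability)]
    exact hΦ.integrableOn
  have hH := hΨ.integral_prod_right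
  have h0 : ∀ r : Ioi (0 : ℝ), 0 ≤ ∫ θ, Ψ (θ, r) ∂(volume : Measure E).toSphere :=
    fun r => integral_nonneg fun θ => hΦ0 _
  obtain ⟨r, hr, hle⟩ := exists_le_setAverage hs_zero hs_top hH.integrableOn
  refine ⟨r, ⟨not_lt.1 hr.2, hr.1⟩, ?_⟩
  rw [setAverage_eq, smul_eq_mul, ← div_eq_inv_mul,
    le_div_iff₀ (show 0 < ν.real s from ENNReal.toReal_pos hs_zero hs_top), mul_comm] at hle
  refine hle.trans ?_
  rw [hint, integral_prod_symm _ hΨ]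
  exact setIntegral_le_integral hH (Eventually.of_forall h0)

lemma lap_eq_sum_fderiv {N : ℕ} (w : EuclideanSpace ℝ (Fin N) → ℝ)
    (x : EuclideanSpace ℝ (Fin N)) :
    lap w x = ∑ i : Fin N, fderiv ℝ (fderiv ℝ w) x (EuclideanSpace.single i 1)
      (EuclideanSpace.single i 1) := by
  simp [lap, iteratedFDeriv_two_apply]

lemma norm_gradient_sq_eq_sum {N : ℕ} (w : EuclideanSpace ℝ (Fin N) → ℝ)
    (x : EuclideanSpace ℝ (Fin N)) :
    ‖gradient w x‖ ^ 2 = ∑ i : Fin N, fderiv ℝ w x (EuclideanSpace.single i 1) ^ 2 := by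
  rw [EuclideanSpace.norm_sq_eq]
  refine Finset.sum_congr rfl fun i _ => ?_
  rw [← inner_gradient_left, EuclideanSpace.inner_single_right]
  simp

lemma fderiv_comp_smul_sub_const {N : ℕ} (w : EuclideanSpace ℝ (Fin N) → ℝ) (R k : ℝ) :
    fderiv ℝ (fun y => w (R • y) - k) = fun y => R • fderiv ℝ w (R • y) := by
  ext1 y
  rw [fderiv_sub_const, fderiv_comp_smul]

lemma lap_comp_smul_sub_const {N : ℕ} (w : EuclideanSpace ℝ (Fin N) → ℝ) (R k : ℝ)
    (y : EuclideanSpace ℝ (Fin N)) :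
    lap (fun y => w (R • y) - k) y = R ^ 2 * lap w (R • y) := by
  simp only [lap_eq_sum_fderiv, fderiv_comp_smul_sub_const, Finset.mul_sum]
  refine Finset.sum_congr rfl fun i _ => ?_
  have h : fderiv ℝ (fun y => R • fderiv ℝ w (R • y)) y
      = R • (R • fderiv ℝ (fderiv ℝ w) (R • y)) := by
    rw [← fderiv_comp_smul]
    exact congrFun (fderiv_const_smul_field R (f := fun y => fderiv ℝ w (R • y))) y
  rw [h]
  simp [pow_two, mul_assoc]

lemma norm_gradient_comp_smul_sub_const {N : ℕ} (w : EuclideanSpace ℝ (Fin N) → ℝ) (R k : ℝ)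
    (y : EuclideanSpace ℝ (Fin N)) :
    ‖gradient (fun y => w (R • y) - k) y‖ ^ 2 = R ^ 2 * ‖gradient w (R • y)‖ ^ 2 := by
  simp only [norm_gradient_sq_eq_sum, fderiv_comp_smul_sub_const, Finset.mul_sum]
  simp [mul_pow]

section Caccioppoli

variable {N : ℕ} {η w : EuclideanSpace ℝ (Fin N) → ℝ} {U : Set (EuclideanSpace ℝ (Fin N))}

/-- The field whose divergence is the integrand of the Caccioppoli identity. -/
noncomputable def caccioppoliField (η w : EuclideanSpace ℝ (Fin N) → ℝ)
    (e x : EuclideanSpace ℝ (Fin N)) : ℝ :=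
  2 * (η x * w x * fderiv ℝ w x e) - w x ^ 2 * fderiv ℝ η x e

lemma ContDiffAt.contDiffAt_fderiv_apply {f : EuclideanSpace ℝ (Fin N) → ℝ}
    {x : EuclideanSpace ℝ (Fin N)} (hf : ContDiffAt ℝ 2 f x) (e : EuclideanSpace ℝ (Fin N)) :
    ContDiffAt ℝ 1 (fun x => fderiv ℝ f x e) x :=
  (hf.fderiv_right (m := 1) (by norm_num)).clm_apply contDiffAt_const

lemma caccioppoliField_eventuallyEq_zero (e : EuclideanSpace ℝ (Fin N))
    {x : EuclideanSpace ℝ (Fin N)} (hx : x ∉ tsupport η) :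
    caccioppoliField η w e =ᶠ[nhds x] 0 := by
  have h := notMem_tsupport_iff_eventuallyEq.1 hx
  filter_upwards [h, h.fderiv (𝕜 := ℝ)] with y h1 h2
  simp [caccioppoliField, h1, h2]

lemma hasCompactSupport_caccioppoliField (hη : HasCompactSupport η)
    (e : EuclideanSpace ℝ (Fin N)) : HasCompactSupport (caccioppoliField η w e) := by
  refine HasCompactSupport.intro hη fun x hx => ?_
  exact (caccioppoliField_eventuallyEq_zero e hx).self_of_nhds

lemma contDiff_caccioppoliField (hη : ContDiff ℝ 2 η) (hU : IsOpen U) (hηU : tsupport η ⊆ U)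
    (hw : ContDiffOn ℝ 2 w U) (e : EuclideanSpace ℝ (Fin N)) :
    ContDiff ℝ 1 (caccioppoliField η w e) := by
  rw [contDiff_iff_contDiffAt]
  intro x
  by_cases hx : x ∈ tsupport η
  · have hwx : ContDiffAt ℝ 2 w x := hw.contDiffAt (hU.mem_nhds (hηU hx))
    have h1 := hwx.contDiffAt_fderiv_apply e
    have h2 := (hη.contDiffAt (x := x)).contDiffAt_fderiv_apply e
    have h3 : ContDiffAt ℝ 1 w x := hwx.of_le (by norm_num)
    have h4 : ContDiffAt ℝ 1 η x := hη.contDiffAt.of_le (by norm_num)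
    exact (contDiffAt_const.mul ((h4.mul h3).mul h1)).sub ((h3.pow 2).mul h2)
  · exact contDiffAt_const.congr_of_eventuallyEq (caccioppoliField_eventuallyEq_zero e hx)

lemma fderiv_caccioppoliField (hη : ContDiff ℝ 2 η) (e : EuclideanSpace ℝ (Fin N))
    {x : EuclideanSpace ℝ (Fin N)} (hw : ContDiffAt ℝ 2 w x) :
    fderiv ℝ (caccioppoliField η w e) x e =
      2 * η x * fderiv ℝ w x e ^ 2 + 2 * η x * w x * fderiv ℝ (fderiv ℝ w) x e e
        - w x ^ 2 * fderiv ℝ (fderiv ℝ η) x e e := by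
  have key : ∀ {f : EuclideanSpace ℝ (Fin N) → ℝ}, ContDiffAt ℝ 2 f x →
      HasFDerivAt f (fderiv ℝ f x) x ∧
      HasFDerivAt (fun x => fderiv ℝ f x e) ((fderiv ℝ (fderiv ℝ f) x).flip e) x := by
    intro f hf
    refine ⟨(hf.differentiableAt (by norm_num)).hasFDerivAt, ?_⟩
    have := ((hf.fderiv_right (m := 1) (by norm_num)).differentiableAt
      (by norm_num)).hasFDerivAt.clm_apply (hasFDerivAt_const e x)
    simpa using this
  obtain ⟨h1, h2⟩ := key hw
  obtain ⟨h3, h4⟩ := key hη.contDiffAt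
  have h := (((h3.mul h1).mul h2).const_mul 2).sub ((h1.pow 2).mul h4)
  have h' : HasFDerivAt (caccioppoliField η w e) _ x := h
  rw [h'.fderiv]
  simp
  ring

lemma integral_fderiv_apply_eq_zero {f : EuclideanSpace ℝ (Fin N) → ℝ} (hf : ContDiff ℝ 1 f)
    (hc : HasCompactSupport f) (e : EuclideanSpace ℝ (Fin N)) :
    Integrable (fun x => fderiv ℝ f x e) ∧ ∫ x, fderiv ℝ f x e = 0 := by
  have hi : Integrable (fun x => fderiv ℝ f x e) :=
    ((hf.continuous_fderiv (by norm_num)).clm_apply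
      continuous_const).integrable_of_hasCompactSupport (hc.fderiv_apply (𝕜 := ℝ) e)
  refine ⟨hi, ?_⟩
  have := integral_mul_fderiv_eq_neg_fderiv_mul_of_integrable (μ := volume)
    (f := fun _ : EuclideanSpace ℝ (Fin N) => (1 : ℝ)) (g := f) (v := e)
    (by simp) (by simpa using hi)
    (by simpa using hf.continuous.integrable_of_hasCompactSupport hc)
    (fun _ _ => differentiableAt_const _)
    (fun x _ => (hf.differentiable (by norm_num)).differentiableAt)
  simpa using this

lemma continuous_mul_norm_gradient_sq (hη : Continuous η) (hU : IsOpen U)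
    (hηU : tsupport η ⊆ U) (hw : ContDiffOn ℝ 2 w U) :
    Continuous (fun x => η x * ‖gradient w x‖ ^ 2) := by
  rw [continuous_iff_continuousAt]
  intro x
  by_cases hx : x ∈ tsupport η
  · have hwx : ContDiffAt ℝ 2 w x := hw.contDiffAt (hU.mem_nhds (hηU hx))
    have : ContinuousAt (gradient w) x :=
      (InnerProductSpace.toDual ℝ _).symm.continuous.continuousAt.comp
        (hwx.fderiv_right (m := 1) (by norm_num)).continuousAt
    exact hη.continuousAt.mul (this.norm.pow 2)
  · refine (continuousAt_const (y := (0 : ℝ))).congr ?_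
    filter_upwards [notMem_tsupport_iff_eventuallyEq.1 hx] with y hy
    simp [hy]

lemma integrable_mul_norm_gradient_sq (hη : Continuous η) (hηc : HasCompactSupport η)
    (hU : IsOpen U) (hηU : tsupport η ⊆ U) (hw : ContDiffOn ℝ 2 w U) :
    Integrable (fun x => η x * ‖gradient w x‖ ^ 2) :=
  (continuous_mul_norm_gradient_sq hη hU hηU hw).integrable_of_hasCompactSupport hηc.mul_right

/-- **Caccioppoli inequality** with a fixed cutoff function. -/
lemma exists_integral_mul_norm_gradient_sq_le (hη : ContDiff ℝ 2 η) (hηc : HasCompactSupport η) :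
    ∃ C : ℝ, 0 ≤ C ∧ ∀ (U : Set (EuclideanSpace ℝ (Fin N)))
      (w : EuclideanSpace ℝ (Fin N) → ℝ) (δ M : ℝ), IsOpen U → tsupport η ⊆ U →
      ContDiffOn ℝ 2 w U → 0 ≤ δ → (∀ x ∈ tsupport η, |w x| ≤ δ) →
      (∀ x ∈ tsupport η, |lap w x| ≤ M) →
      ∫ x, η x * ‖gradient w x‖ ^ 2 ≤ C * (δ ^ 2 + δ * M) := by
  have hlapc : Continuous (lap η) := by
    simp only [funext (lap_eq_sum_fderiv η)]
    have : Continuous (fderiv ℝ (fderiv ℝ η)) :=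
      (hη.fderiv_right (m := 1) (by norm_num)).continuous_fderiv (by norm_num)
    fun_prop
  obtain ⟨A, hA⟩ := hηc.isCompact.exists_bound_of_continuousOn hlapc.continuousOn
  obtain ⟨B, hB⟩ := hηc.isCompact.exists_bound_of_continuousOn hη.continuous.continuousOn
  set C₀ : ℝ := max (A / 2) B ⊔ 0
  refine ⟨C₀ * volume.real (tsupport η), by positivity, ?_⟩
  intro U w δ M hU hηU hw hδ hwδ hwM
  have hdiv : ∀ i : Fin N, _ := fun i => integral_fderiv_apply_eq_zero
    (contDiff_caccioppoliField hη hU hηU hw (EuclideanSpace.single i 1))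
    (hasCompactSupport_caccioppoliField hηc _) (EuclideanSpace.single i 1)
  set D : EuclideanSpace ℝ (Fin N) → ℝ := fun x => ∑ i : Fin N,
    fderiv ℝ (caccioppoliField η w (EuclideanSpace.single i 1)) x (EuclideanSpace.single i 1)
  have hDi : Integrable D := integrable_finsetSum _ fun i _ => (hdiv i).1
  have hD0 : ∫ x, D x = 0 := by
    rw [integral_finsetSum _ fun i _ => (hdiv i).1]
    exact Finset.sum_eq_zero fun i _ => (hdiv i).2
  have hpt : ∀ x, η x * ‖gradient w x‖ ^ 2 ≤
      D x / 2 + (tsupport η).indicator (fun _ => C₀ * (δ ^ 2 + δ * M)) x := by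
    intro x
    by_cases hx : x ∈ tsupport η
    · have hwx : ContDiffAt ℝ 2 w x := hw.contDiffAt (hU.mem_nhds (hηU hx))
      have hDx : D x = 2 * η x * ‖gradient w x‖ ^ 2 + 2 * η x * w x * lap w x
          - w x ^ 2 * lap η x := by
        simp only [D, fderiv_caccioppoliField hη _ hwx, norm_gradient_sq_eq_sum,
          lap_eq_sum_fderiv, Finset.mul_sum, Finset.sum_add_distrib, Finset.sum_sub_distrib]
      rw [indicator_of_mem hx, hDx]
      have hM : 0 ≤ M := (abs_nonneg _).trans (hwM x hx)
      have h1 : |w x ^ 2 * (lap η x / 2)| ≤ δ ^ 2 * C₀ := by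
        rw [abs_mul, abs_pow, abs_div, abs_two]
        have : |lap η x| ≤ A := hA x hx
        have h3 : |lap η x| / 2 ≤ C₀ :=
          (by linarith : |lap η x| / 2 ≤ A / 2).trans ((le_max_left _ _).trans (le_max_left _ _))
        gcongr
        exact hwδ x hx
      have h2 : |η x * (w x * lap w x)| ≤ C₀ * (δ * M) := by
        rw [abs_mul, abs_mul]
        have h3 : |η x| ≤ C₀ := (hB x hx).trans ((le_max_right _ _).trans (le_max_left _ _))
        gcongr
        exacts [hwδ x hx, hwM x hx]
      have h1' := (abs_le.1 h1).2
      have h2' := (abs_le.1 h2).1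
      linarith
    · have hη : η x = 0 := image_eq_zero_of_notMem_tsupport hx
      have : D x = 0 := Finset.sum_eq_zero fun i _ => by
        rw [(caccioppoliField_eventuallyEq_zero _ hx).fderiv_eq]
        simp
      simp [hη, this, hx]
  have hind : Integrable ((tsupport η).indicator fun _ => C₀ * (δ ^ 2 + δ * M)) :=
    (integrable_indicator_iff (isClosed_tsupport η).measurableSet).2
      (integrableOn_const hηc.isCompact.measure_lt_top.ne)
  calc ∫ x, η x * ‖gradient w x‖ ^ 2
      ≤ ∫ x, (D x / 2 + (tsupport η).indicator (fun _ => C₀ * (δ ^ 2 + δ * M)) x) :=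
        integral_mono (integrable_mul_norm_gradient_sq hη.continuous hηc hU hηU hw)
          ((hDi.div_const 2).add hind) hpt
    _ = C₀ * volume.real (tsupport η) * (δ ^ 2 + δ * M) := by
        rw [integral_add (hDi.div_const 2) hind, integral_div, hD0,
          integral_indicator (isClosed_tsupport η).measurableSet, setIntegral_const, smul_eq_mul]
        ring

end Caccioppoli

lemma exists_annular_cutoff (N : ℕ) :
    ∃ η : EuclideanSpace ℝ (Fin N) → ℝ, ContDiff ℝ 2 η ∧ HasCompactSupport η ∧
      (∀ x, 0 ≤ η x) ∧ 0 ∉ tsupport η ∧ ∀ x, 1 ≤ ‖x‖ → ‖x‖ ≤ 2 → η x = 1 := by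
  let f : ContDiffBump (0 : EuclideanSpace ℝ (Fin N)) := ⟨2, 3, by norm_num, by norm_num⟩
  let g : ContDiffBump (0 : EuclideanSpace ℝ (Fin N)) := ⟨1 / 2, 1, by norm_num, by norm_num⟩
  refine ⟨fun x => f x * (1 - g x), f.contDiff.mul (contDiff_const.sub g.contDiff),
    f.hasCompactSupport.mul_right, fun x => mul_nonneg f.nonneg (sub_nonneg.2 g.le_one),
    ?_, fun x h1 h2 => ?_⟩
  · rw [notMem_tsupport_iff_eventuallyEq]
    filter_upwards [g.eventuallyEq_one] with x hx
    simp [hx]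
  · simp only
    rw [f.one_of_mem_closedBall (by simpa using h2), g.zero_of_le_dist (by simpa using h1)]
    simp

/-- Scaled Dirichlet energies over annuli shrinking to the origin tend to zero. -/
lemma tendsto_integral_scaled_gradient_sq {N : ℕ} {Ω : Set (EuclideanSpace ℝ (Fin N))}
    (hΩ : IsOpen Ω) (h0 : (0 : EuclideanSpace ℝ (Fin N)) ∈ Ω)
    {u η : EuclideanSpace ℝ (Fin N) → ℝ} (hu : ContinuousOn u Ω)
    (hu2 : ContDiffOn ℝ 2 u (Ω \ {0})) {M : ℝ}
    (hM : ∀ᶠ x in nhds 0, x ≠ 0 → ‖x‖ ^ 2 * |lap u x| ≤ M)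
    (hη : ContDiff ℝ 2 η) (hηc : HasCompactSupport η) (hη0 : ∀ x, 0 ≤ η x)
    (h0η : 0 ∉ tsupport η) :
    (∀ᶠ R in nhdsWithin 0 (Ioi (0 : ℝ)),
      Integrable (fun y => η y * (R ^ 2 * ‖gradient u (R • y)‖ ^ 2))) ∧
    Tendsto (fun R : ℝ => ∫ y, η y * (R ^ 2 * ‖gradient u (R • y)‖ ^ 2))
      (nhdsWithin 0 (Ioi 0)) (nhds 0) := by
  obtain ⟨C, hC0, hC⟩ := exists_integral_mul_norm_gradient_sq_le hη hηc
  obtain ⟨L, hLpos, hL⟩ := hηc.isCompact.isBounded.exists_pos_norm_le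
  obtain ⟨m, hm, hmb⟩ : ∃ m : ℝ, 0 < m ∧ ∀ y ∈ tsupport η, m ≤ ‖y‖ := by
    obtain ⟨m, hm, hmb⟩ := Metric.isOpen_iff.1 (isClosed_tsupport η).isOpen_compl 0 h0η
    refine ⟨m, hm, fun y hy => ?_⟩
    by_contra! h
    exact hmb (by simpa using h) hy
  have hscale : ∀ s ∈ nhds (0 : EuclideanSpace ℝ (Fin N)),
      ∀ᶠ R in nhdsWithin 0 (Ioi (0 : ℝ)), ∀ y ∈ tsupport η, R • y ∈ s := by
    intro s hs
    obtain ⟨ε, hε, hεs⟩ := Metric.mem_nhds_iff.1 hs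
    filter_upwards [Ioo_mem_nhdsGT (div_pos hε hLpos)] with R hR y hy
    apply hεs
    rw [mem_ball_zero_iff, norm_smul, Real.norm_of_nonneg hR.1.le]
    calc R * ‖y‖ ≤ R * L := by gcongr; exacts [hR.1.le, hL y hy]
      _ < ε := (lt_div_iff₀ hLpos).1 hR.2
  have hU : ∀ R : ℝ, IsOpen ((fun y : EuclideanSpace ℝ (Fin N) => R • y) ⁻¹' (Ω \ {0})) :=
    fun R => (hΩ.sdiff isClosed_singleton).preimage (continuous_const_smul R)
  have hw : ∀ R : ℝ, ContDiffOn ℝ 2 (fun y => u (R • y) - u 0)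
      ((fun y : EuclideanSpace ℝ (Fin N) => R • y) ⁻¹' (Ω \ {0})) := fun R =>
    (hu2.comp (contDiff_const_smul R).contDiffOn (mapsTo_preimage _ _)).sub contDiffOn_const
  have hsub : ∀ᶠ R in nhdsWithin 0 (Ioi (0 : ℝ)),
      tsupport η ⊆ (fun y : EuclideanSpace ℝ (Fin N) => R • y) ⁻¹' (Ω \ {0}) := by
    filter_upwards [hscale Ω (hΩ.mem_nhds h0), self_mem_nhdsWithin] with R hR hR0 y hy
    have hy0 : y ≠ 0 := fun h => h0η (h ▸ hy)
    exact ⟨hR y hy, smul_ne_zero (ne_of_gt hR0) hy0⟩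
  have hlap : ∀ᶠ R in nhdsWithin 0 (Ioi (0 : ℝ)), ∀ y ∈ tsupport η,
      |lap (fun y => u (R • y) - u 0) y| ≤ M / m ^ 2 := by
    filter_upwards [hscale _ hM, self_mem_nhdsWithin] with R hR hR0 y hy
    have hy0 : y ≠ 0 := fun h => h0η (h ▸ hy)
    have h1 := hR y hy (smul_ne_zero (ne_of_gt hR0) hy0)
    rw [lap_comp_smul_sub_const, abs_mul, abs_of_nonneg (sq_nonneg R),
      le_div_iff₀ (by positivity)]
    rw [norm_smul, mul_pow, Real.norm_eq_abs, sq_abs] at h1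
    have h2 : m ^ 2 ≤ ‖y‖ ^ 2 := by gcongr; exact hmb y hy
    calc R ^ 2 * |lap u (R • y)| * m ^ 2 ≤ R ^ 2 * |lap u (R • y)| * ‖y‖ ^ 2 := by gcongr
      _ ≤ M := by linarith
  have hcongr : ∀ R : ℝ, (fun y => η y * (R ^ 2 * ‖gradient u (R • y)‖ ^ 2)) =
      fun y => η y * ‖gradient (fun y => u (R • y) - u 0) y‖ ^ 2 := fun R => by
    simp only [norm_gradient_comp_smul_sub_const]
  refine ⟨?_, ?_⟩
  · filter_upwards [hsub] with R hR
    rw [hcongr]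
    exact integrable_mul_norm_gradient_sq hη.continuous hηc (hU R) hR (hw R)
  · rw [Metric.tendsto_nhds]
    intro ε hε
    have hlim : Tendsto (fun δ : ℝ => C * (δ ^ 2 + δ * (M / m ^ 2)))
        (nhdsWithin 0 (Ioi 0)) (nhds 0) := by
      have : Continuous fun δ : ℝ => C * (δ ^ 2 + δ * (M / m ^ 2)) := by fun_prop
      simpa using (this.tendsto 0).mono_left nhdsWithin_le_nhds
    obtain ⟨δ, hδε, hδ⟩ := ((hlim.eventually_lt_const hε).and self_mem_nhdsWithin).exists
    have hδ0 : (0 : ℝ) < δ := hδ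
    have hosc := (hu.continuousAt (hΩ.mem_nhds h0)).eventually (Metric.ball_mem_nhds (u 0) hδ0)
    filter_upwards [hsub, hlap, hscale _ hosc] with R h1 h2 h3
    have hle := hC _ _ δ (M / m ^ 2) (hU R) h1 (hw R) hδ0.le
      (fun y hy => le_of_lt (h3 y hy)) h2
    rw [← hcongr R] at hle
    rw [Real.dist_eq, sub_zero, abs_of_nonneg
      (integral_nonneg fun y => mul_nonneg (hη0 y) (by positivity))]
    exact hle.trans_lt hδε

lemma eventually_norm_sq_mul_abs_lap_le {N : ℕ} {Ω : Set (EuclideanSpace ℝ (Fin N))}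
    (hΩ : IsOpen Ω) (h0 : (0 : EuclideanSpace ℝ (Fin N)) ∈ Ω)
    {u v : EuclideanSpace ℝ (Fin N) → ℝ} {a p : ℝ} (ha : -2 < a) (hp : 0 < p)
    (hv : ContinuousOn v Ω) (hv0 : ∀ x ∈ Ω, 0 < v x)
    (heq : ∀ x ∈ Ω \ {0}, -lap u x = ‖x‖ ^ a * v x ^ p) :
    ∀ᶠ x in nhds 0, x ≠ 0 → ‖x‖ ^ 2 * |lap u x| ≤ (v 0 + 1) ^ p := by
  have hv1 := (hv.continuousAt (hΩ.mem_nhds h0)).eventually_lt_const (lt_add_one (v 0))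
  filter_upwards [hΩ.mem_nhds h0, hv1, Metric.ball_mem_nhds 0 one_pos] with x hx hvx hx1 hx0
  have hn : 0 < ‖x‖ := norm_pos_iff.2 hx0
  have hvp := hv0 x hx
  rw [← abs_neg, heq x ⟨hx, hx0⟩, abs_of_nonneg (by positivity), ← mul_assoc,
    ← Real.rpow_natCast, ← Real.rpow_add hn]
  have h1 : ‖x‖ ^ (((2 : ℕ) : ℝ) + a) ≤ 1 :=
    Real.rpow_le_one hn.le (le_of_lt (by simpa using hx1)) (by push_cast; linarith)
  calc _ ≤ 1 * v x ^ p := by gcongr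
    _ ≤ (v 0 + 1) ^ p := by rw [one_mul]; gcongr

/-- Lemma 6.1 (first part): for a positive solution of the Hardy–Hénon system on a domain
containing the origin, there is a sequence of radii `ε i → 0` along which the surface integral
of `|∇u|² + |∇v|²` over the sphere of radius `ε i` tends to `0`. -/
theorem gradient_sphere_integral_vanishes
    (N : ℕ) (hN : 3 ≤ N) (a b p q : ℝ) (ha : -2 < a) (hb : -2 < b)
    (hp : 0 < p) (hq : 0 < q) (hpq : 1 < p * q)
    (Ω : Set (EuclideanSpace ℝ (Fin N))) (hΩo : IsOpen Ω) (hΩc : IsConnected Ω)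
    (h0 : (0 : EuclideanSpace ℝ (Fin N)) ∈ Ω)
    (u v : EuclideanSpace ℝ (Fin N) → ℝ) (huv : IsHHSol a b p q Ω u v) :
    ∃ ε : ℕ → ℝ, (∀ i, 0 < ε i) ∧ Tendsto ε atTop (nhds 0) ∧
      Tendsto (fun i => sphInt (ε i)
          (fun x => ‖gradient u x‖ ^ 2 + ‖gradient v x‖ ^ 2))
        atTop (nhds 0) := by
  obtain ⟨hu, hv, hu2, hv2, hu0, hv0, hequ, heqv⟩ := huv
  obtain ⟨η, hη, hηc, hη0, h0η, hη1⟩ := exists_annular_cutoff N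
  obtain ⟨hui, hut⟩ := tendsto_integral_scaled_gradient_sq hΩo h0 hu hu2
    (eventually_norm_sq_mul_abs_lap_le hΩo h0 ha hp hv hv0 hequ) hη hηc hη0 h0η
  obtain ⟨hvi, hvt⟩ := tendsto_integral_scaled_gradient_sq hΩo h0 hv hv2
    (eventually_norm_sq_mul_abs_lap_le hΩo h0 hb hq hu hu0 heqv) hη hηc hη0 h0η
  obtain ⟨c, hc, hcr⟩ := exists_sphere_integral_le (N := N) (by lia)
  set g : EuclideanSpace ℝ (Fin N) → ℝ := fun x => ‖gradient u x‖ ^ 2 + ‖gradient v x‖ ^ 2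
  set T : ℝ → ℝ := fun R => (∫ y, η y * (R ^ 2 * ‖gradient u (R • y)‖ ^ 2)) +
    ∫ y, η y * (R ^ 2 * ‖gradient v (R • y)‖ ^ 2)
  have hT : Tendsto T (nhdsWithin 0 (Ioi 0)) (nhds 0) := by simpa using hut.add hvt
  have hg0 : ∀ x, 0 ≤ g x := fun x => by positivity
  have hsph0 : ∀ R, 0 ≤ R → 0 ≤ sphInt R g := fun R hR =>
    mul_nonneg (pow_nonneg hR _) (integral_nonneg fun _ => hg0 _)
  have hradius : ∀ᶠ R in nhdsWithin 0 (Ioi (0 : ℝ)), ∃ s, 0 < s ∧ s ≤ 2 * R ∧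
      sphInt s g ≤ 2 ^ (N - 1) / c * T R := by
    filter_upwards [hui, hvi, Ioo_mem_nhdsGT one_pos] with R h1 h2 hR
    have hR0 : 0 < R := hR.1
    obtain ⟨r, hr, hle⟩ := hcr (fun y => η y * (R ^ 2 * g (R • y)))
      (fun y => mul_nonneg (hη0 y) (mul_nonneg (sq_nonneg R) (hg0 _)))
      ((h1.add h2).congr (Eventually.of_forall fun y => by simp only [Pi.add_apply, g]; ring))
    have hr0 : 0 < r := one_pos.trans_le hr.1
    have hTR : ∫ y, η y * (R ^ 2 * g (R • y)) = T R := by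
      simp only [T, g, mul_add]
      exact integral_add h1 h2
    set J : ℝ := ∫ θ : sphere (0 : EuclideanSpace ℝ (Fin N)) 1,
      g ((R * r) • (θ : EuclideanSpace ℝ (Fin N)))
        ∂((volume : Measure (EuclideanSpace ℝ (Fin N))).toSphere)
    have hJ0 : 0 ≤ J := integral_nonneg fun _ => hg0 _
    have hJ : c * (R ^ 2 * J) ≤ T R := by
      rw [hTR] at hle
      convert hle using 2
      rw [← integral_const_mul]
      refine integral_congr_ae (Eventually.of_forall fun θ => ?_)
      have hθ : ‖r • (θ : EuclideanSpace ℝ (Fin N))‖ = r := by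
        simp [norm_smul, abs_of_pos hr0]
      simp only
      rw [hη1 _ (by rw [hθ]; exact hr.1) (by rw [hθ]; exact hr.2.le), one_mul, smul_smul]
    refine ⟨R * r, by positivity, by nlinarith [hr.2], ?_⟩
    have hRpow : R ^ (N - 1) ≤ R ^ 2 := pow_le_pow_of_le_one hR0.le hR.2.le (by lia)
    calc sphInt (R * r) g = R ^ (N - 1) * r ^ (N - 1) * J := by
          rw [sphInt, mul_pow]
      _ ≤ R ^ 2 * 2 ^ (N - 1) * J := by gcongr; exact hr.2.le
      _ = 2 ^ (N - 1) / c * (c * (R ^ 2 * J)) := by field_simp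
      _ ≤ 2 ^ (N - 1) / c * T R := by gcongr
  obtain ⟨R₀, hR₀, hR⟩ := mem_nhdsGT_iff_exists_Ioo_subset.1 hradius
  have hR₀ : (0 : ℝ) < R₀ := hR₀
  set ρ : ℕ → ℝ := fun i => R₀ * (1 / ((i + 1 : ℕ) + 1))
  have hρ : ∀ i, ρ i ∈ Ioo 0 R₀ := fun i => by
    refine ⟨by positivity, mul_lt_of_lt_one_right hR₀ ?_⟩
    rw [div_lt_one (by positivity)]
    push_cast
    linarith [(Nat.cast_nonneg i : (0 : ℝ) ≤ i)]
  have hρt : Tendsto ρ atTop (nhds 0) := by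
    simpa [ρ] using ((tendsto_one_div_add_atTop_nhds_zero_nat (𝕜 := ℝ)).comp
      (tendsto_add_atTop_nat 1)).const_mul R₀
  choose ε hε0 hερ hεT using fun i => hR (hρ i)
  refine ⟨ε, hε0, ?_, ?_⟩
  · exact squeeze_zero (fun i => (hε0 i).le) hερ (by simpa using hρt.const_mul 2)
  · refine squeeze_zero (fun i => hsph0 _ (hε0 i).le) hεT ?_
    have := hT.comp (tendsto_nhdsWithin_iff.2 ⟨hρt, Eventually.of_forall fun i => (hρ i).1⟩)
    simpa using this.const_mul (2 ^ (N - 1) / c)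
end

section
/- Let m ∈ ℝ and C₀ > 0, and let F : [1, ∞) → ℝ be a function satisfying F(R) > 0 and F(R) ≤ C₀ R^m for all R ≥ 1. Then for every M > 4^m there exists a sequence R_i → ∞ (with R_i ≥ 1) such that F(4 R_i) ≤ M F(R_i) for every i; equivalently, for every R* ≥ 1 there exists R ≥ R* with F(4R) ≤ M F(R). -/
open Filter

/-- A positive function bounded by `C₀ * R ^ m` cannot grow by a factor larger than `M > 4 ^ m`
under every multiplication of the radius by four. -/
theorem exists_ge_four_mul_le (m C₀ : ℝ) (F : ℝ → ℝ)
    (hFpos : ∀ R : ℝ, 1 ≤ R → 0 < F R)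
    (hFgrowth : ∀ R : ℝ, 1 ≤ R → F R ≤ C₀ * R ^ m)
    {M : ℝ} (hM : (4 : ℝ) ^ m < M) {R₀ : ℝ} (hR₀ : 1 ≤ R₀) :
    ∃ R : ℝ, R₀ ≤ R ∧ F (4 * R) ≤ M * F R := by
  by_contra! hgrow
  have h4 : (0 : ℝ) < 4 ^ m := by positivity
  have hM0 : 0 < M := h4.trans hM
  have hle (k : ℕ) : R₀ ≤ 4 ^ k * R₀ :=
    le_mul_of_one_le_left (by linarith) (one_le_pow₀ (by norm_num))
  have hiter (k : ℕ) : M ^ k * F R₀ ≤ F (4 ^ k * R₀) := by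
    induction k with
    | zero => simp
    | succ k ih =>
      calc M ^ (k + 1) * F R₀ = M * (M ^ k * F R₀) := by ring
        _ ≤ M * F (4 ^ k * R₀) := by gcongr
        _ ≤ F (4 * (4 ^ k * R₀)) := (hgrow _ (hle k)).le
        _ = F (4 ^ (k + 1) * R₀) := by ring_nf
  obtain ⟨k, hk⟩ := pow_unbounded_of_one_lt (C₀ * R₀ ^ m / F R₀) ((one_lt_div h4).2 hM)
  have hupper : M ^ k * F R₀ ≤ (4 ^ m) ^ k * (C₀ * R₀ ^ m) := by
    calc M ^ k * F R₀ ≤ F (4 ^ k * R₀) := hiter k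
      _ ≤ C₀ * (4 ^ k * R₀) ^ m := hFgrowth _ (hR₀.trans (hle k))
      _ = (4 ^ m) ^ k * (C₀ * R₀ ^ m) := by
        rw [Real.mul_rpow (by positivity) (by linarith), Real.rpow_pow_comm (by norm_num)]
        ring
  rw [div_pow, div_lt_div_iff₀ (hFpos _ hR₀) (pow_pos h4 k)] at hk
  linarith

/-- The doubling-type argument from the proof of Theorem 1.1: a positive function with
polynomial growth admits arbitrarily large radii `R` at which `F(4R) ≤ M F(R)`, for any
`M > 4^m`. -/
theorem doubling_radii
    (m : ℝ) (C₀ : ℝ) (hC₀ : 0 < C₀) (F : ℝ → ℝ)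
    (hFpos : ∀ R : ℝ, 1 ≤ R → 0 < F R)
    (hFgrowth : ∀ R : ℝ, 1 ≤ R → F R ≤ C₀ * R ^ m) :
    ∀ M : ℝ, (4 : ℝ) ^ m < M →
      (∃ R : ℕ → ℝ, (∀ i, 1 ≤ R i) ∧ Tendsto R atTop atTop ∧
        ∀ i, F (4 * R i) ≤ M * F (R i)) ∧
      (∀ Rstar : ℝ, 1 ≤ Rstar → ∃ R : ℝ, Rstar ≤ R ∧ F (4 * R) ≤ M * F R) := by
  intro M hM
  refine ⟨?_, fun _ h ↦ exists_ge_four_mul_le m C₀ F hFpos hFgrowth hM h⟩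
  have hex (i : ℕ) : ∃ R : ℝ, (i : ℝ) + 1 ≤ R ∧ F (4 * R) ≤ M * F R :=
    exists_ge_four_mul_le m C₀ F hFpos hFgrowth hM (by simp)
  choose R hRge hRle using hex
  refine ⟨R, fun i ↦ le_trans (by simp) (hRge i), ?_, hRle⟩
  exact tendsto_atTop_mono (fun i ↦ (le_add_of_nonneg_right zero_le_one).trans (hRge i))
    tendsto_natCast_atTop_atTop
end
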